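/- For every natural number n, the real vector space Infr_n of reduced-quaternion-valued inframonogenic homogeneous polynomials of degree n has dimension 6n + 3 over ℝ. -/

import Mathlib

noncomputable section

open MvPolynomial

/-- The space of real polynomials in the three variables `x₀, x₁, x₂`. -/
abbrev P3 := MvPolynomial (Fin 3) ℝ

/-- The partial derivative `∂ᵢ` as a linear operator on polynomials. -/
noncomputable def Dp (i : Fin 3) : P3 →ₗ[ℝ] P3 :=
  (MvPolynomial.pderiv i).toLinearMap

/-- The linear map expressing the system `∂̄f∂̄ = 0` for a reduced-quaternion-valued
polynomial `f = f₀ + f₁e₁ + f₂e₂` (represented as a triple of real polynomials):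
its kernel consists of the triples satisfying
`(∂₀² − ∂₁² − ∂₂²)f₀ − 2∂₀∂₁f₁ − 2∂₀∂₂f₂ = 0`,
`2∂₀∂₁f₀ + (∂₀² − ∂₁² + ∂₂²)f₁ − 2∂₁∂₂f₂ = 0`,
`2∂₀∂₂f₀ − 2∂₁∂₂f₁ + (∂₀² + ∂₁² − ∂₂²)f₂ = 0`. -/
noncomputable def infrSystem : (Fin 3 → P3) →ₗ[ℝ] (Fin 3 → P3) :=
  LinearMap.pi ![
    (Dp 0 ∘ₗ Dp 0 - Dp 1 ∘ₗ Dp 1 - Dp 2 ∘ₗ Dp 2) ∘ₗ LinearMap.proj 0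
      - (2:ℝ) • ((Dp 0 ∘ₗ Dp 1) ∘ₗ LinearMap.proj 1)
      - (2:ℝ) • ((Dp 0 ∘ₗ Dp 2) ∘ₗ LinearMap.proj 2),
    (2:ℝ) • ((Dp 0 ∘ₗ Dp 1) ∘ₗ LinearMap.proj 0)
      + (Dp 0 ∘ₗ Dp 0 - Dp 1 ∘ₗ Dp 1 + Dp 2 ∘ₗ Dp 2) ∘ₗ LinearMap.proj 1
      - (2:ℝ) • ((Dp 1 ∘ₗ Dp 2) ∘ₗ LinearMap.proj 2),
    (2:ℝ) • ((Dp 0 ∘ₗ Dp 2) ∘ₗ LinearMap.proj 0)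
      - (2:ℝ) • ((Dp 1 ∘ₗ Dp 2) ∘ₗ LinearMap.proj 1)
      + (Dp 0 ∘ₗ Dp 0 + Dp 1 ∘ₗ Dp 1 - Dp 2 ∘ₗ Dp 2) ∘ₗ LinearMap.proj 2 ]

/-- `Infr n`: the real vector space of reduced-quaternion-valued inframonogenic
homogeneous polynomials of degree `n`, as triples `(f₀, f₁, f₂)` of homogeneous
polynomials of degree `n` satisfying the system `∂̄f∂̄ = 0`. -/
noncomputable def Infr (n : ℕ) : Submodule ℝ (Fin 3 → P3) :=
  (Submodule.pi Set.univ fun _ : Fin 3 => MvPolynomial.homogeneousSubmodule (Fin 3) ℝ n)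
    ⊓ LinearMap.ker infrSystem

/-- Triples of homogeneous polynomials of degree `n`. -/
abbrev homTriples (n : ℕ) : Submodule ℝ (Fin 3 → P3) :=
  Submodule.pi Set.univ fun _ : Fin 3 => MvPolynomial.homogeneousSubmodule (Fin 3) ℝ n

theorem mem_homTriples {n : ℕ} {f : Fin 3 → P3} :
    f ∈ homTriples n ↔ ∀ i, (f i).IsHomogeneous n := by
  simp [homTriples, Submodule.mem_pi]

/-- The monomials of degree `n` form a basis of the homogeneous polynomials of degree `n`. -/
def homBasis (n : ℕ) : Module.Basis {d : Fin 3 →₀ ℕ | d.degree = n} ℝ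
    (MvPolynomial.homogeneousSubmodule (Fin 3) ℝ n) :=
  (MvPolynomial.basisRestrictSupport ℝ {d : Fin 3 →₀ ℕ | d.degree = n}).map
    (LinearEquiv.ofEq _ _ (MvPolynomial.homogeneousSubmodule_eq_finsupp_supported _ _ n).symm)

theorem degree_eq_coe_finsuppAntidiag (n : ℕ) :
    {d : Fin 3 →₀ ℕ | d.degree = n} = ↑((Finset.univ : Finset (Fin 3)).finsuppAntidiag n) := by
  ext d
  simp [Finset.mem_finsuppAntidiag, Finsupp.degree_eq_sum]

instance (n : ℕ) : Finite {d : Fin 3 →₀ ℕ | d.degree = n} := by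
  rw [degree_eq_coe_finsuppAntidiag]
  exact Finset.finite_toSet _

instance (n : ℕ) : Module.Finite ℝ (MvPolynomial.homogeneousSubmodule (Fin 3) ℝ n) :=
  Module.Finite.of_basis (homBasis n)

theorem finrank_homogeneousSubmodule (n : ℕ) :
    Module.finrank ℝ (MvPolynomial.homogeneousSubmodule (Fin 3) ℝ n) = (n + 2).choose 2 := by
  rw [Module.finrank_eq_nat_card_basis (homBasis n), degree_eq_coe_finsuppAntidiag,
    Nat.card_coe_set_eq, Set.ncard_coe_finset, Finset.card_finsuppAntidiag_nat_eq_choose,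
    Finset.card_univ, Fintype.card_fin, ← Nat.choose_symm_add]
  congr 1
  omega

/-- A triple of homogeneous polynomials is a function into the homogeneous polynomials. -/
def homTriplesEquiv (n : ℕ) :
    homTriples n ≃ₗ[ℝ] (Fin 3 → MvPolynomial.homogeneousSubmodule (Fin 3) ℝ n) where
  toFun f i := ⟨f.1 i, mem_homTriples.1 f.2 i⟩
  invFun g := ⟨fun i => (g i).1, mem_homTriples.2 fun i => (g i).2⟩
  map_add' _ _ := rfl
  map_smul' _ _ := rfl
  left_inv _ := rfl
  right_inv _ := rfl

instance (n : ℕ) : Module.Finite ℝ (homTriples n) :=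
  Module.Finite.equiv (homTriplesEquiv n).symm

theorem finrank_homTriples (n : ℕ) :
    Module.finrank ℝ (homTriples n) = 3 * (n + 2).choose 2 := by
  rw [(homTriplesEquiv n).finrank_eq, Module.finrank_pi_fintype]
  simp [finrank_homogeneousSubmodule]

theorem finrank_map_add_finrank_Infr (n : ℕ) :
    Module.finrank ℝ ((homTriples n).map infrSystem) + Module.finrank ℝ (Infr n) =
      Module.finrank ℝ (homTriples n) := by
  rw [← (infrSystem.domRestrict (homTriples n)).finrank_range_add_finrank_ker,
    LinearMap.range_domRestrict, LinearMap.ker_domRestrict, Infr,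
    ← Submodule.map_comap_subtype, Submodule.finrank_map_subtype_eq]

theorem infrSystem_apply (f : Fin 3 → P3) :
    infrSystem f =
      ![Dp 0 (Dp 0 (f 0)) - Dp 1 (Dp 1 (f 0)) - Dp 2 (Dp 2 (f 0))
          - (2 : ℝ) • Dp 0 (Dp 1 (f 1)) - (2 : ℝ) • Dp 0 (Dp 2 (f 2)),
        (2 : ℝ) • Dp 0 (Dp 1 (f 0))
          + (Dp 0 (Dp 0 (f 1)) - Dp 1 (Dp 1 (f 1)) + Dp 2 (Dp 2 (f 1)))
          - (2 : ℝ) • Dp 1 (Dp 2 (f 2)),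
        (2 : ℝ) • Dp 0 (Dp 2 (f 0)) - (2 : ℝ) • Dp 1 (Dp 2 (f 1))
          + (Dp 0 (Dp 0 (f 2)) + Dp 1 (Dp 1 (f 2)) - Dp 2 (Dp 2 (f 2)))] := by
  funext i
  fin_cases i <;> rfl

theorem infrSystem_mem (n : ℕ) {f : Fin 3 → P3} (hf : f ∈ homTriples (n + 2)) :
    infrSystem f ∈ homTriples n := by
  have h (i k l : Fin 3) : Dp k (Dp l (f i)) ∈ MvPolynomial.homogeneousSubmodule (Fin 3) ℝ n :=
    ((mem_homTriples.1 hf i).pderiv (i := l)).pderiv (i := k)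
  have h' (i k l : Fin 3) :
      (2 : ℝ) • Dp k (Dp l (f i)) ∈ MvPolynomial.homogeneousSubmodule (Fin 3) ℝ n :=
    Submodule.smul_mem _ _ (h i k l)
  rw [infrSystem_apply, mem_homTriples]
  intro i
  rw [← MvPolynomial.mem_homogeneousSubmodule]
  fin_cases i
  · exact sub_mem (sub_mem (sub_mem (sub_mem (h _ _ _) (h _ _ _)) (h _ _ _)) (h' _ _ _)) (h' _ _ _)
  · exact sub_mem (add_mem (h' _ _ _) (add_mem (sub_mem (h _ _ _) (h _ _ _)) (h _ _ _))) (h' _ _ _)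
  · exact add_mem (sub_mem (h' _ _ _) (h' _ _ _)) (sub_mem (add_mem (h _ _ _) (h _ _ _)) (h _ _ _))

theorem Dp_Dp_eq_zero {n : ℕ} (hn : n < 2) {p : P3} (hp : p.IsHomogeneous n) (k l : Fin 3) :
    Dp k (Dp l p) = 0 := by
  have h : (Dp l p).IsHomogeneous 0 := by
    have := hp.pderiv (i := l)
    rwa [show n - 1 = 0 by omega] at this
  rw [MvPolynomial.totalDegree_eq_zero_iff_eq_C.1 (Nat.le_zero.1 h.totalDegree_le)]
  exact MvPolynomial.pderiv_C

theorem map_infrSystem_of_lt_two {n : ℕ} (hn : n < 2) :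
    (homTriples n).map infrSystem = ⊥ := by
  rw [eq_bot_iff, Submodule.map_le_iff_le_comap]
  intro f hf
  have h (i k l : Fin 3) := Dp_Dp_eq_zero hn (mem_homTriples.1 hf i) k l
  rw [Submodule.mem_comap, Submodule.mem_bot, infrSystem_apply]
  simp only [h]
  funext i
  fin_cases i <;> simp

theorem Dp_monomial (i : Fin 3) (s : Fin 3 →₀ ℕ) (c : ℝ) :
    Dp i (monomial s c) = monomial (s - Finsupp.single i 1) (c * s i) :=
  MvPolynomial.pderiv_monomial

/-- A second-order derivative of a monomial, other than `∂₀²`, lowers the degree in `x₁, x₂`. -/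
theorem exists_Dp_Dp_monomial {n : ℕ} {s : Fin 3 →₀ ℕ} (hs : s.degree = n + 2) (c : ℝ)
    {k l : Fin 3} (hl : l ≠ 0) :
    Dp k (Dp l (monomial s c)) = 0 ∨ ∃ (t : Fin 3 →₀ ℕ) (r : ℝ),
      Dp k (Dp l (monomial s c)) = monomial t r ∧ t.degree = n ∧ t 1 + t 2 < s 1 + s 2 := by
  rw [Dp_monomial, Dp_monomial]
  by_cases h₁ : s l = 0
  · simp [h₁]
  by_cases h₂ : (s - Finsupp.single l 1 : Fin 3 →₀ ℕ) k = 0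
  · rw [h₂]
    simp
  refine .inr ⟨_, _, rfl, ?_⟩
  simp only [Finsupp.degree_eq_sum, Fin.sum_univ_three, Finsupp.tsub_apply,
    Finsupp.single_apply] at *
  fin_cases l <;> fin_cases k <;> simp at * <;> omega

theorem single_monomial_mem_map (n : ℕ) (t : Fin 3 →₀ ℕ) (ht : t.degree = n) (i : Fin 3) (r : ℝ) :
    Pi.single i (monomial t r) ∈ (homTriples (n + 2)).map infrSystem := by
  induction hN : t 1 + t 2 using Nat.strong_induction_on generalizing t i r with
  | _ N ih =>
  set c : ℝ := r / ((t 0 + 1) * (t 0 + 2)) with hc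
  set s : Fin 3 →₀ ℕ := t + Finsupp.single 0 2 with hs
  set u : P3 := monomial s c with hu
  have hs1 : s 1 = t 1 := by simp [hs]
  have hs2 : s 2 = t 2 := by simp [hs]
  have hdeg : s.degree = n + 2 := by simp [hs, ht]
  have h00 : Dp 0 (Dp 0 u) = monomial t r := by
    rw [hu, Dp_monomial, Dp_monomial]
    have hsub : s - Finsupp.single 0 1 - Finsupp.single 0 1 = t := by
      rw [hs, tsub_tsub, ← Finsupp.single_add, add_tsub_cancel_right]
    have hcoef : c * s 0 * ((s - Finsupp.single 0 1 : Fin 3 →₀ ℕ) 0 : ℕ) = r := by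
      simp [hs, hc]
      field_simp
    rw [hsub, hcoef]
  have hlow (j k l : Fin 3) (hl : l ≠ 0) :
      Pi.single j (Dp k (Dp l u)) ∈ (homTriples (n + 2)).map infrSystem := by
    rcases exists_Dp_Dp_monomial hdeg c (k := k) hl with h | ⟨t', r', h, hd, hlt⟩
    · rw [hu, h, Pi.single_zero]
      exact zero_mem _
    · rw [hu, h]
      exact ih _ (by omega) t' hd j r' rfl
  have hlow' (j k l : Fin 3) (hl : l ≠ 0) :
      Pi.single j ((2 : ℝ) • Dp k (Dp l u)) ∈ (homTriples (n + 2)).map infrSystem := by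
    rw [Pi.single_smul]
    exact Submodule.smul_mem _ _ (hlow j k l hl)
  have hu_mem : infrSystem (Pi.single i u) ∈ (homTriples (n + 2)).map infrSystem := by
    refine Submodule.mem_map_of_mem (mem_homTriples.2 fun j => ?_)
    rcases eq_or_ne j i with rfl | hj
    · rw [Pi.single_eq_same]
      exact isHomogeneous_monomial _ hdeg
    · rw [Pi.single_eq_of_ne hj]
      exact isHomogeneous_zero _ _ _
  rw [← h00]
  have h1 : (1 : Fin 3) ≠ 0 := by decide
  have h2 : (2 : Fin 3) ≠ 0 := by decide
  fin_cases i
  · have key : (Pi.single 0 (Dp 0 (Dp 0 u)) : Fin 3 → P3) = infrSystem (Pi.single 0 u)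
        + Pi.single 0 (Dp 1 (Dp 1 u)) + Pi.single 0 (Dp 2 (Dp 2 u))
        - Pi.single 1 ((2 : ℝ) • Dp 0 (Dp 1 u)) - Pi.single 2 ((2 : ℝ) • Dp 0 (Dp 2 u)) := by
      rw [infrSystem_apply]
      funext j
      fin_cases j <;> simp [Matrix.vecHead, Matrix.vecTail] <;> ring
    exact key ▸ sub_mem (sub_mem (add_mem (add_mem hu_mem (hlow _ _ _ h1)) (hlow _ _ _ h2))
      (hlow' _ _ _ h1)) (hlow' _ _ _ h2)
  · have key : (Pi.single 1 (Dp 0 (Dp 0 u)) : Fin 3 → P3) = infrSystem (Pi.single 1 u)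
        + Pi.single 0 ((2 : ℝ) • Dp 0 (Dp 1 u)) + Pi.single 1 (Dp 1 (Dp 1 u))
        - Pi.single 1 (Dp 2 (Dp 2 u)) + Pi.single 2 ((2 : ℝ) • Dp 1 (Dp 2 u)) := by
      rw [infrSystem_apply]
      funext j
      fin_cases j <;> simp [Matrix.vecHead, Matrix.vecTail] <;> ring
    exact key ▸ add_mem (sub_mem (add_mem (add_mem hu_mem (hlow' _ _ _ h1)) (hlow _ _ _ h1))
      (hlow _ _ _ h2)) (hlow' _ _ _ h2)
  · have key : (Pi.single 2 (Dp 0 (Dp 0 u)) : Fin 3 → P3) = infrSystem (Pi.single 2 u)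
        + Pi.single 0 ((2 : ℝ) • Dp 0 (Dp 2 u)) + Pi.single 1 ((2 : ℝ) • Dp 1 (Dp 2 u))
        - Pi.single 2 (Dp 1 (Dp 1 u)) + Pi.single 2 (Dp 2 (Dp 2 u)) := by
      rw [infrSystem_apply]
      funext j
      fin_cases j <;> simp [Matrix.vecHead, Matrix.vecTail] <;> ring
    exact key ▸ add_mem (sub_mem (add_mem (add_mem hu_mem (hlow' _ _ _ h2)) (hlow' _ _ _ h2))
      (hlow _ _ _ h1)) (hlow _ _ _ h2)

theorem map_infrSystem (n : ℕ) : (homTriples (n + 2)).map infrSystem = homTriples n := by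
  refine le_antisymm (Submodule.map_le_iff_le_comap.2 fun f hf => infrSystem_mem n hf)
    fun g hg => ?_
  rw [← Finset.univ_sum_single g]
  refine Submodule.sum_mem _ fun i _ => ?_
  have hi := mem_homTriples.1 hg i
  rw [(g i).as_sum, ← LinearMap.coe_single ℝ (fun _ : Fin 3 => P3) i, map_sum]
  refine Submodule.sum_mem _ fun t ht => single_monomial_mem_map n t ?_ i _
  exact (hi.degree_eq_sum_deg_support ht).symm

/-- `dim_ℝ Infr_n = 6n + 3`. -/
theorem stmt6 (n : ℕ) : Module.finrank ℝ (Infr n) = 6 * n + 3 := by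
  have h := finrank_map_add_finrank_Infr n
  rw [finrank_homTriples] at h
  match n with
  | 0 =>
    rw [map_infrSystem_of_lt_two (by norm_num), finrank_bot] at h
    simpa using h
  | 1 =>
    rw [map_infrSystem_of_lt_two (by norm_num), finrank_bot] at h
    simpa [Nat.choose] using h
  | n + 2 =>
    rw [map_infrSystem, finrank_homTriples] at h
    simp only [Nat.choose_succ_succ', zero_add, Nat.choose_zero_right, Nat.choose_one_right] at h
    omega
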